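/- arXiv:2110.09387 — 6 statements merged into one kernel-verified Lean document; each statement's English description precedes it below -/
import Mathlib

section
/- Let k be a field with a separable closure k^s, and let q ∈ k[X] be an irreducible polynomial of degree 2. Then q is not separable if and only if the image of q in k^s[X] is irreducible. -/
/-- Let `k` be a field with separable closure `kˢ`, and let `q ∈ k[X]` be an
irreducible polynomial of degree 2.  Then `q` is not separable if and only if the image of `q`
in `kˢ[X]` is irreducible.  Here the separable closure `kˢ` is realized as the separable closure
of `k` inside an algebraic closure of `k`. -/
theorem inseparable_iff_irreducible_map_sepClosure
    (k : Type*) [Field k] (q : Polynomial k)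
    (hirr : Irreducible q) (hdeg : q.natDegree = 2) :
    ¬ q.Separable ↔
      Irreducible (q.map (algebraMap k (separableClosure k (AlgebraicClosure k)))) := by
  have hd : (q.map (algebraMap k (separableClosure k (AlgebraicClosure k)))).natDegree = 2 := by
    rw [Polynomial.natDegree_map, hdeg]
  have : IsSepClosed (separableClosure k (AlgebraicClosure k)) :=
    (separableClosure.isSepClosure k (AlgebraicClosure k)).sep_closed
  constructor
  · intro hns
    rw [Polynomial.irreducible_iff_roots_eq_zero_of_degree_le_three (by omega) (by omega)]
    by_contra hne
    obtain ⟨x, hx⟩ := Multiset.exists_mem_of_ne_zero hne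
    have hx0 := Polynomial.isRoot_of_mem_roots hx
    have hx1 : Polynomial.aeval x q = 0 := by
      rw [Polynomial.IsRoot.def, Polynomial.eval_map_algebraMap] at hx0
      exact hx0
    have hsep : IsSeparable k x := Algebra.IsSeparable.isSeparable k x
    have hdvd := minpoly.dvd k x hx1
    have hass : Associated (minpoly k x) q :=
      (minpoly.irreducible hsep.isIntegral).associated_of_dvd hirr hdvd
    exact hns (Polynomial.Separable.of_dvd hsep hass.symm.dvd)
  · intro hi hs
    have h1 := IsSepClosed.degree_eq_one_of_irreducible _ hi hs.map
    have h2 := (Polynomial.degree_eq_iff_natDegree_eq_of_pos (n := 1) one_pos).1 h1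
    omega
end

section
/- Let R be a reduced Noetherian commutative ring of characteristic 2 that is F-finite, i.e. R is finitely generated as a module over its subring R² = {r² : r ∈ R} (the image of the Frobenius endomorphism). Let A be any subring of R with R² ⊆ A ⊆ R. Then A is a Noetherian ring, R is finitely generated as an A-module, and A is itself F-finite (A is finitely generated as a module over its subring A² = {a² : a ∈ A}). -/
/-- Let `R` be a reduced Noetherian commutative ring of characteristic 2 that
is F-finite, i.e. finitely generated as a module over the subring `R² = {r² : r ∈ R}` (the
range of the Frobenius).  If `A` is any subring with `R² ⊆ A ⊆ R`, then `A` is Noetherian, `R`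
is a finitely generated `A`-module, and `A` is itself F-finite (finitely generated as a module
over `A² = {a² : a ∈ A}`). -/
theorem subring_between_frobenius_range_isNoetherian_finite_fFinite
    (R : Type*) [CommRing R] [IsReduced R] [IsNoetherianRing R] [CharP R 2]
    (hF : Module.Finite (frobenius R 2).range R)
    (A : Subring R) (hA : (frobenius R 2).range ≤ A) :
    IsNoetherianRing A ∧ Module.Finite A R ∧
      Module.Finite (frobenius A 2).range A := by
  have hN : IsNoetherianRing (frobenius R 2).range :=
    isNoetherianRing_of_surjective R _ (frobenius R 2).rangeRestrict
      (frobenius R 2).rangeRestrict_surjective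
  let j : (frobenius R 2).range →+* A := Subring.inclusion hA
  have hj : j.Finite := by
    letI := j.toAlgebra
    let l : A →ₗ[(frobenius R 2).range] R :=
      { toFun := fun a => (a : R)
        map_add' := fun _ _ => rfl
        map_smul' := fun _ _ => rfl }
    exact Module.Finite.of_injective l Subtype.val_injective
  have hNA : IsNoetherianRing A := by
    letI := j.toAlgebra
    haveI : Module.Finite (frobenius R 2).range A := hj
    exact IsNoetherianRing.of_finite (frobenius R 2).range A
  have hR : A.subtype.Finite := by
    refine RingHom.Finite.of_comp_finite (f := j) ?_
    have h : (frobenius R 2).range.subtype.Finite := hF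
    exact h
  have hfr : (frobenius A 2).Finite := by
    have h := (hj.comp (RingHom.Finite.of_surjective (frobenius R 2).rangeRestrict
      (frobenius R 2).rangeRestrict_surjective)).comp hR
    exact h
  refine ⟨hNA, hR, ?_⟩
  have h : (frobenius A 2).range.subtype.Finite :=
    RingHom.Finite.of_comp_finite (f := (frobenius A 2).rangeRestrict) hfr
  exact h
end

section
/- Let k be a field of characteristic 2 and let A = k[u,v,w]/(w v² − u²). Then A is an integral domain, the k-algebra homomorphism A → k[t,s] (a polynomial ring in two variables) determined by u ↦ t·s, v ↦ s, w ↦ t² is injective, and it identifies k[t,s] with the integral closure of A in its field of fractions (in particular the fraction fields of A and k[t,s] coincide under this embedding, with t corresponding to u/v). -/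
open MvPolynomial

/-- The coordinate ring `A = k[u,v,w]/(w v² - u²)`, where `u = X 0`, `v = X 1`, `w = X 2`. -/
noncomputable abbrev NodalSurfaceRing (k : Type*) [Field k] : Type _ :=
  MvPolynomial (Fin 3) k ⧸
    Ideal.span {(X 2 * X 1 ^ 2 - X 0 ^ 2 : MvPolynomial (Fin 3) k)}

/-- The `k`-algebra map `A → k[t,s]` determined by `u ↦ t·s`, `v ↦ s`, `w ↦ t²`,
where `t = X 0` and `s = X 1` in `k[t,s]`. -/
noncomputable def nodalSurfaceToPlane (k : Type*) [Field k] :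
    NodalSurfaceRing k →+* MvPolynomial (Fin 2) k :=
  Ideal.Quotient.lift _
    ((aeval ![(X 0 * X 1 : MvPolynomial (Fin 2) k), X 1, X 0 ^ 2]).toRingHom)
    (by
      intro a ha
      rw [Ideal.mem_span_singleton] at ha
      obtain ⟨c, rfl⟩ := ha
      rw [map_mul]
      convert zero_mul _
      simp [Matrix.cons_val_zero, Matrix.cons_val_one]
      ring)

theorem nodalSurface_aux_mk (k : Type*) [Field k] (f : MvPolynomial (Fin 3) k) :
    nodalSurfaceToPlane k (Ideal.Quotient.mk _ f) =
      aeval ![(X 0 * X 1 : MvPolynomial (Fin 2) k), X 1, X 0 ^ 2] f := rfl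

/-- Normal form modulo the relation. -/
theorem nodalSurface_aux_normal (k : Type*) [Field k] (f : MvPolynomial (Fin 3) k) :
    ∃ a b : MvPolynomial (Fin 2) k, ∃ c : MvPolynomial (Fin 3) k,
      f = aeval ![(X 2 : MvPolynomial (Fin 3) k), X 1] a
        + X 0 * aeval ![(X 2 : MvPolynomial (Fin 3) k), X 1] b
        + (X 2 * X 1 ^ 2 - X 0 ^ 2) * c := by
  induction f using MvPolynomial.induction_on with
  | C r => exact ⟨C r, 0, 0, by simp [MvPolynomial.algebraMap_eq]⟩
  | add p q hp hq =>
    obtain ⟨a, b, c, h⟩ := hp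
    obtain ⟨a', b', c', h'⟩ := hq
    refine ⟨a + a', b + b', c + c', ?_⟩
    rw [map_add, map_add]
    linear_combination h + h'
  | mul_X p i hp =>
    obtain ⟨a, b, c, h⟩ := hp
    fin_cases i
    · refine ⟨X 0 * X 1 ^ 2 * b, a, X 0 * c - aeval ![(X 2 : MvPolynomial (Fin 3) k), X 1] b, ?_⟩
      simp only [map_mul, map_pow, aeval_X, Matrix.cons_val_zero, Matrix.cons_val_one, Fin.zero_eta]
      linear_combination X 0 * h
    · refine ⟨X 1 * a, X 1 * b, X 1 * c, ?_⟩
      simp only [map_mul, aeval_X, Matrix.cons_val_one, Matrix.cons_val_zero, Fin.mk_one]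
      linear_combination X 1 * h
    · refine ⟨X 0 * a, X 0 * b, X 2 * c, ?_⟩
      simp only [map_mul, aeval_X, Matrix.cons_val_zero, Fin.reduceFinMk]
      linear_combination X 2 * h

theorem nodalSurface_aux_inj0 (k : Type*) [Field k] (a : MvPolynomial (Fin 2) k)
    (h : aeval ![(X 0 ^ 2 : MvPolynomial (Fin 2) k), X 1] a = 0) : a = 0 := by
  have key : (aeval ![(X 0 : MvPolynomial (Fin 2) k), X 1 ^ 2]).comp
      (aeval ![(X 0 ^ 2 : MvPolynomial (Fin 2) k), X 1]) = expand (R := k) (σ := Fin 2) 2 := by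
    apply MvPolynomial.algHom_ext
    intro i
    fin_cases i <;> simp
  rw [← expand_eq_zero (p := 2) two_pos, ← key, AlgHom.comp_apply, h, map_zero]

theorem nodalSurface_aux_deriv (k : Type*) [Field k] [CharP k 2] (a : MvPolynomial (Fin 2) k) :
    pderiv 0 (aeval ![(X 0 ^ 2 : MvPolynomial (Fin 2) k), X 1] a) = 0 := by
  have h2 : (2 : MvPolynomial (Fin 2) k) = 0 := by
    have := CharP.cast_eq_zero (MvPolynomial (Fin 2) k) 2
    exact_mod_cast this
  induction a using MvPolynomial.induction_on with
  | C r => simp [MvPolynomial.algebraMap_eq]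
  | add p q hp hq => rw [map_add, map_add, hp, hq, add_zero]
  | mul_X p i hp =>
    rw [map_mul, Derivation.leibniz, hp]
    fin_cases i <;> simp [pderiv_X, Derivation.leibniz_pow, h2]

theorem nodalSurface_aux_inj (k : Type*) [Field k] [CharP k 2] :
    Function.Injective (nodalSurfaceToPlane k) := by
  rw [injective_iff_map_eq_zero]
  intro x hx
  obtain ⟨f, rfl⟩ := Ideal.Quotient.mk_surjective x
  rw [nodalSurface_aux_mk] at hx
  obtain ⟨a, b, c, rfl⟩ := nodalSurface_aux_normal k f
  have key : (aeval ![(X 0 * X 1 : MvPolynomial (Fin 2) k), X 1, X 0 ^ 2]).comp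
      (aeval ![(X 2 : MvPolynomial (Fin 3) k), X 1])
      = aeval (R := k) ![(X 0 ^ 2 : MvPolynomial (Fin 2) k), X 1] := by
    apply MvPolynomial.algHom_ext
    intro i
    fin_cases i <;> simp
  have key' := fun p => DFunLike.congr_fun key p
  simp only [AlgHom.comp_apply] at key'
  have hx' : aeval ![(X 0 ^ 2 : MvPolynomial (Fin 2) k), X 1] a
      + X 0 * X 1 * aeval ![(X 0 ^ 2 : MvPolynomial (Fin 2) k), X 1] b = 0 := by
    rw [← key', ← key', ← hx]
    simp only [map_add, map_mul, map_sub, map_pow, aeval_X, Matrix.cons_val]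
    ring
  have hb : b = 0 := by
    apply nodalSurface_aux_inj0
    have := congrArg (pderiv 0) hx'
    rw [map_add, nodalSurface_aux_deriv, Derivation.leibniz, nodalSurface_aux_deriv] at this
    simpa [pderiv_X, Derivation.leibniz] using this
  subst hb
  have ha : a = 0 := by
    apply nodalSurface_aux_inj0
    simpa using hx'
  subst ha
  rw [Ideal.Quotient.eq_zero_iff_mem, Ideal.mem_span_singleton]
  exact ⟨c, by simp⟩

theorem nodalSurface_aux_integral (k : Type*) [Field k] :
    (nodalSurfaceToPlane k).IsIntegral := by
  intro p
  induction p using MvPolynomial.induction_on with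
  | C r =>
    have : (C r : MvPolynomial (Fin 2) k) = nodalSurfaceToPlane k (Ideal.Quotient.mk _ (C r)) := by
      rw [nodalSurface_aux_mk]; simp [MvPolynomial.algebraMap_eq]
    rw [this]
    exact RingHom.isIntegralElem_map _
  | add p q hp hq => exact hp.add _ hq
  | mul_X p i hp =>
    apply hp.mul
    fin_cases i
    · refine ⟨Polynomial.X ^ 2 - Polynomial.C (Ideal.Quotient.mk _ (X 2)),
        Polynomial.monic_X_pow_sub_C _ two_ne_zero, ?_⟩
      rw [Polynomial.eval₂_sub, Polynomial.eval₂_C, nodalSurface_aux_mk]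
      simp
    · have : (X 1 : MvPolynomial (Fin 2) k) = nodalSurfaceToPlane k (Ideal.Quotient.mk _ (X 1)) := by
        rw [nodalSurface_aux_mk]; simp
      change (nodalSurfaceToPlane k).IsIntegralElem (X 1)
      rw [this]
      exact RingHom.isIntegralElem_map _

theorem nodalSurface_aux_frac (k : Type*) [Field k] (p : MvPolynomial (Fin 2) k) :
    ∃ (x : NodalSurfaceRing k) (n : ℕ), nodalSurfaceToPlane k x = p * X 1 ^ n := by
  have h0 : nodalSurfaceToPlane k (Ideal.Quotient.mk _ (X 0)) = X 0 * X 1 := by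
    rw [nodalSurface_aux_mk]; simp
  have h1 : nodalSurfaceToPlane k (Ideal.Quotient.mk _ (X 1)) = X 1 := by
    rw [nodalSurface_aux_mk]; simp
  induction p using MvPolynomial.induction_on with
  | C r =>
    refine ⟨Ideal.Quotient.mk _ (C r), 0, ?_⟩
    rw [nodalSurface_aux_mk]; simp [MvPolynomial.algebraMap_eq]
  | add p q hp hq =>
    obtain ⟨x, n, hx⟩ := hp
    obtain ⟨y, m, hy⟩ := hq
    refine ⟨x * (Ideal.Quotient.mk _ (X 1)) ^ m + y * (Ideal.Quotient.mk _ (X 1)) ^ n, n + m, ?_⟩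
    rw [map_add, map_mul, map_mul, map_pow, map_pow, h1, hx, hy]
    ring
  | mul_X p i hp =>
    obtain ⟨x, n, hx⟩ := hp
    fin_cases i
    · refine ⟨x * Ideal.Quotient.mk _ (X 0), n + 1, ?_⟩
      rw [map_mul, h0, hx]
      simp only [Fin.zero_eta]
      ring
    · refine ⟨x * Ideal.Quotient.mk _ (X 1), n, ?_⟩
      rw [map_mul, h1, hx]
      simp only [Fin.mk_one]
      ring

set_option synthInstance.maxHeartbeats 2000000 in
set_option maxHeartbeats 4000000 in
/-- Let `k` be a field of characteristic 2 and `A = k[u,v,w]/(w v² - u²)`.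
Then `A` is an integral domain, the `k`-algebra map `A → k[t,s]` with `u ↦ t·s`, `v ↦ s`,
`w ↦ t²` is injective, and it identifies `k[t,s]` with the integral closure of `A` in its
field of fractions: the integral elements of `Frac(k[t,s])` over `A` are exactly the image of
`k[t,s]`, and `Frac(k[t,s])` is also a fraction field of `A` (so the two fraction fields
coincide), with `t` corresponding to `u/v` (i.e. `t · v = u`). -/
theorem nodalSurface_normalization
    (k : Type*) [Field k] [CharP k 2] :
    letI : Algebra (NodalSurfaceRing k) (FractionRing (MvPolynomial (Fin 2) k)) :=
      ((algebraMap (MvPolynomial (Fin 2) k) (FractionRing (MvPolynomial (Fin 2) k))).comp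
        (nodalSurfaceToPlane k)).toAlgebra
    IsDomain (NodalSurfaceRing k) ∧
    Function.Injective (nodalSurfaceToPlane k) ∧
    (∀ y : FractionRing (MvPolynomial (Fin 2) k),
      IsIntegral (NodalSurfaceRing k) y ↔
        ∃ p : MvPolynomial (Fin 2) k,
          algebraMap (MvPolynomial (Fin 2) k) (FractionRing (MvPolynomial (Fin 2) k)) p = y) ∧
    IsFractionRing (NodalSurfaceRing k) (FractionRing (MvPolynomial (Fin 2) k)) ∧
    algebraMap (MvPolynomial (Fin 2) k) (FractionRing (MvPolynomial (Fin 2) k)) (X 0) *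
        algebraMap (NodalSurfaceRing k) (FractionRing (MvPolynomial (Fin 2) k))
          (Ideal.Quotient.mk _ (X 1)) =
      algebraMap (NodalSurfaceRing k) (FractionRing (MvPolynomial (Fin 2) k))
        (Ideal.Quotient.mk _ (X 0)) := by
  have inj := nodalSurface_aux_inj k
  have h1 : nodalSurfaceToPlane k (Ideal.Quotient.mk _ (X 1)) = X 1 := by
    rw [nodalSurface_aux_mk]; simp
  have h0 : nodalSurfaceToPlane k (Ideal.Quotient.mk _ (X 0)) = X 0 * X 1 := by
    rw [nodalSurface_aux_mk]; simp
  letI alg : Algebra (NodalSurfaceRing k) (FractionRing (MvPolynomial (Fin 2) k)) :=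
      ((algebraMap (MvPolynomial (Fin 2) k) (FractionRing (MvPolynomial (Fin 2) k))).comp
        (nodalSurfaceToPlane k)).toAlgebra
  have halg : ∀ x, algebraMap (NodalSurfaceRing k) (FractionRing (MvPolynomial (Fin 2) k)) x =
      algebraMap (MvPolynomial (Fin 2) k) (FractionRing (MvPolynomial (Fin 2) k))
        (nodalSurfaceToPlane k x) := fun _ => rfl
  have hinjK : Function.Injective
      (algebraMap (MvPolynomial (Fin 2) k) (FractionRing (MvPolynomial (Fin 2) k))) :=
    IsFractionRing.injective _ _
  refine ⟨inj.isDomain (nodalSurfaceToPlane k), inj, ?_, ?_, ?_⟩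
  · intro y
    constructor
    · rintro ⟨p, hp, hy⟩
      apply (IsIntegrallyClosed.isIntegral_iff (R := MvPolynomial (Fin 2) k)).1
      refine ⟨p.map (nodalSurfaceToPlane k), hp.map _, ?_⟩
      rw [Polynomial.eval₂_map]
      exact hy
    · rintro ⟨p, rfl⟩
      obtain ⟨q, hq, hp⟩ := nodalSurface_aux_integral k p
      refine ⟨q, hq, ?_⟩
      have := congrArg
        (algebraMap (MvPolynomial (Fin 2) k) (FractionRing (MvPolynomial (Fin 2) k))) hp
      rw [Polynomial.hom_eval₂, map_zero] at this
      exact this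
  · haveI : FaithfulSMul (NodalSurfaceRing k) (FractionRing (MvPolynomial (Fin 2) k)) :=
      (faithfulSMul_iff_algebraMap_injective _ _).2 (hinjK.comp inj)
    apply IsFractionRing.of_field
    intro z
    obtain ⟨p, q, hq, rfl⟩ := IsFractionRing.div_surjective (A := MvPolynomial (Fin 2) k) z
    obtain ⟨x, n, hx⟩ := nodalSurface_aux_frac k p
    obtain ⟨y, m, hy⟩ := nodalSurface_aux_frac k q
    refine ⟨x * (Ideal.Quotient.mk _ (X 1)) ^ m, y * (Ideal.Quotient.mk _ (X 1)) ^ n, ?_⟩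
    rw [halg, halg, map_mul (nodalSurfaceToPlane k), map_mul (nodalSurfaceToPlane k),
      map_pow (nodalSurfaceToPlane k), map_pow (nodalSurfaceToPlane k), h1, hx, hy]
    have hq0 : algebraMap (MvPolynomial (Fin 2) k) (FractionRing (MvPolynomial (Fin 2) k)) q ≠ 0 :=
      (map_ne_zero_iff _ hinjK).2 (nonZeroDivisors.ne_zero hq)
    have hs0 : algebraMap (MvPolynomial (Fin 2) k) (FractionRing (MvPolynomial (Fin 2) k)) (X 1)
        ≠ 0 := (map_ne_zero_iff _ hinjK).2 (X_ne_zero 1)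
    simp only [map_mul, map_pow]
    field_simp
  · rw [halg, halg, h0, h1, map_mul]
end

section
/- Let K be a field of characteristic different from 2 and let τ be a K-algebra automorphism of the formal power series ring K[[X]] with τ ∘ τ = id such that τ(X) − X ∈ (X)². Then τ is the identity. -/
open PowerSeries

/-- Let `K` be a field of characteristic `≠ 2` and let `τ` be a `K`-algebra
automorphism of `K[[X]]` with `τ ∘ τ = id` and `τ X - X ∈ (X)²`.  Then `τ` is the identity. -/
theorem algEquiv_powerSeries_eq_refl_of_involution
    (K : Type*) [Field K] (hK : ringChar K ≠ 2)
    (τ : PowerSeries K ≃ₐ[K] PowerSeries K)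
    (hinv : ∀ f : PowerSeries K, τ (τ f) = f)
    (hX : τ (PowerSeries.X : PowerSeries K) - PowerSeries.X
      ∈ (Ideal.span {(PowerSeries.X : PowerSeries K)}) ^ 2) :
    τ = AlgEquiv.refl := by
  have h2 : (2 : K) ≠ 0 := Ring.two_ne_zero hK
  rw [Ideal.span_singleton_pow, Ideal.mem_span_singleton] at hX
  obtain ⟨w, hw⟩ := hX
  have hv : τ (PowerSeries.X : PowerSeries K) = PowerSeries.X * (1 + PowerSeries.X * w) := by
    linear_combination hw
  have hτC : ∀ c : K, τ (PowerSeries.C c) = PowerSeries.C c := fun c => τ.commutes c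
  have h0 : ∀ g : PowerSeries K, constantCoeff (τ g) = constantCoeff g := by
    intro g
    have h := g.eq_X_mul_shift_add_const
    generalize (PowerSeries.mk fun p => coeff (p + 1) g) = s at h
    have h' := congrArg (fun x => constantCoeff (τ x)) h
    simpa [hv, hτC] using h'
  have key : ∀ (k : ℕ) (f : PowerSeries K), (PowerSeries.X : PowerSeries K) ^ k ∣ f →
      (PowerSeries.X : PowerSeries K) ^ (k + 1) ∣ τ f - f := by
    rintro k f ⟨g, rfl⟩
    have : τ (PowerSeries.X ^ k * g) - PowerSeries.X ^ k * g
        = PowerSeries.X ^ k * ((1 + PowerSeries.X * w) ^ k * τ g - g) := by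
      rw [map_mul, map_pow, hv, mul_pow]; ring
    rw [this, pow_succ]
    refine mul_dvd_mul_left _ ?_
    rw [PowerSeries.X_dvd_iff]
    simp [h0]
  have main : ∀ (f : PowerSeries K) (n : ℕ), (PowerSeries.X : PowerSeries K) ^ n ∣ τ f - f := by
    intro f n
    induction n with
    | zero => simp
    | succ n ih =>
      have h := key n _ ih
      have e : τ f - f = (τ (τ f - f) - (τ f - f)) * PowerSeries.C (-(2 : K)⁻¹) := by
        have hc : (2 : PowerSeries K) * PowerSeries.C ((2 : K)⁻¹) = 1 := by
          rw [← map_ofNat (PowerSeries.C (R := K)) 2, ← map_mul, mul_inv_cancel₀ h2, map_one]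
        rw [map_sub, hinv, map_neg]
        linear_combination (f - τ f) * hc
      rw [e]
      exact Dvd.dvd.mul_right h _
  ext1 f
  refine sub_eq_zero.mp ?_
  ext n
  simpa using (PowerSeries.X_pow_dvd_iff.mp (main f (n + 1))) n (Nat.lt_succ_self n)
end

section
/- Let k be a field and let Y be a scheme that is proper over Spec k and connected, and assume that the structure map k → H⁰(Y, O_Y) is bijective. Then Y is geometrically connected: for every field extension K of k, the base change Y ×_{Spec k} Spec K is connected. -/
open AlgebraicGeometry CategoryTheory CategoryTheory.Limits

universe u

theorem aux_eq_bot (X : Scheme.{u}) (U V : X.Opens) (hUV : U ⊔ V = ⊤) (hd : U ⊓ V = ⊥)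
    (hX : ∀ e : Γ(X, ⊤), e * e = e → e = 0 ∨ e = 1) : U = ⊥ ∨ V = ⊥ := by
  have hs : Subsingleton Γ(X, U ⊓ V) := by rw [hd]; infer_instance
  rw [← hUV] at hX
  have hbot : ∀ W : X.Opens, (1 : Γ(X, W)) = 0 → W = ⊥ := by
    intro W h
    have h1 : X.basicOpen (1 : Γ(X, W)) = W := Scheme.basicOpen_of_isUnit _ isUnit_one
    rw [← h1, h, Scheme.basicOpen_zero]
  let x : RingHom.eqLocus
      (RingHom.comp (X.sheaf.obj.map (homOfLE inf_le_left : U ⊓ V ⟶ U).op).hom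
        (RingHom.fst (X.sheaf.obj.obj <| .op U) (X.sheaf.obj.obj <| .op V)))
      (RingHom.comp (X.sheaf.obj.map (homOfLE inf_le_right : U ⊓ V ⟶ V).op).hom
        (RingHom.snd (X.sheaf.obj.obj <| .op U) (X.sheaf.obj.obj <| .op V))) :=
    ⟨(1, 0), hs.elim _ _⟩
  let e : Γ(X, U ⊔ V) := (X.sheaf.objSupIsoProdEqLocus U V).inv x
  have hx : x * x = x := Subtype.ext (Prod.ext (one_mul _) (zero_mul _))
  have he : e * e = e := by
    have := congrArg (X.sheaf.objSupIsoProdEqLocus U V).inv.hom hx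
    rw [map_mul] at this
    exact this
  have h1 : X.presheaf.map (homOfLE le_sup_left : U ⟶ U ⊔ V).op e = 1 :=
    X.sheaf.objSupIsoProdEqLocus_inv_fst U V x
  have h2 : X.presheaf.map (homOfLE le_sup_right : V ⟶ U ⊔ V).op e = 0 :=
    X.sheaf.objSupIsoProdEqLocus_inv_snd U V x
  rcases hX e he with h | h
  · left; apply hbot; rw [← h1, h, map_zero]
  · right; apply hbot; rw [← h2, h, map_one]

theorem aux_connected (X : Scheme.{u}) [Nonempty X]
    (hX : ∀ e : Γ(X, ⊤), e * e = e → e = 0 ∨ e = 1) : ConnectedSpace X := by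
  have : PreconnectedSpace X := by
    rw [preconnectedSpace_iff_clopen]
    intro s hs
    rcases aux_eq_bot X ⟨s, hs.isOpen⟩ ⟨sᶜ, hs.compl.isOpen⟩ (by ext; simp)
      (by ext; simp) hX with h | h
    · left; simpa using congrArg (fun W : X.Opens => (W : Set X)) h
    · right; simpa using congrArg (fun W : X.Opens => (W : Set X)) h
  exact ⟨inferInstance⟩

set_option synthInstance.maxHeartbeats 400000 in
set_option maxHeartbeats 1000000 in
/-- Let `k` be a field and `Y` a scheme, proper over `Spec k` and connected,
such that the structure map `k → H⁰(Y, O_Y)` is bijective.  Then `Y` is geometrically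
connected: for every field extension `K` of `k`, the base change `Y ×_{Spec k} Spec K` is
connected. -/
theorem geometrically_connected_of_global_sections_eq_base
    (k : Type u) [Field k] (Y : Scheme.{u})
    (f : Y ⟶ Spec (CommRingCat.of k))
    [IsProper f] [ConnectedSpace Y]
    (hbij : Function.Bijective
      ((Scheme.ΓSpecIso (CommRingCat.of k)).inv ≫ f.appTop)) :
    ∀ (K : Type u) [Field K] [Algebra k K],
      ConnectedSpace
        ↥(pullback f (Spec.map (CommRingCat.ofHom (algebraMap k K)))) := by
  intro K _ _
  set g := Spec.map (CommRingCat.ofHom (algebraMap k K)) with hg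
  have hiso : IsIso f.appTop := by
    have : IsIso ((Scheme.ΓSpecIso (CommRingCat.of k)).inv ≫ f.appTop) :=
      (ConcreteCategory.isIso_iff_bijective _).mpr hbij
    exact IsIso.of_isIso_comp_left (Scheme.ΓSpecIso (CommRingCat.of k)).inv _
  have hflat : Flat g := by infer_instance
  have hsurj : Surjective g := by infer_instance
  have hne : Nonempty ↥(pullback f g) := by
    obtain ⟨z, -⟩ := (pullback.fst f g).surjective (Classical.arbitrary Y)
    exact ⟨z⟩
  have hY : CompactSpace Y := (quasiCompact_iff_compactSpace f).mp inferInstance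
  have hYq : QuasiSeparatedSpace Y := (quasiSeparated_iff_quasiSeparatedSpace f).mp inferInstance
  have hp := isIso_pushoutSection_of_isQuasiSeparated_of_flat_right
    (IsPullback.of_hasPullback f g) (US := ⊤) (UT := ⊤) (UX := ⊤) (UY := ⊤) le_top le_top (by simp)
    (isAffineOpen_top _) (isAffineOpen_top _) isCompact_univ (isQuasiSeparated_univ)
  replace hp := (isIso_pushoutSection_iff (IsPullback.of_hasPullback f g) (US := ⊤) (UT := ⊤)
    (UX := ⊤) (UY := ⊤) le_top le_top (by simp)).mp hp
  have hp2 : IsIso (pullback.snd f g).appTop := by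
    have h0 : IsIso (f.appLE ⊤ ⊤ le_top) := by
      rwa [show f.appLE ⊤ ⊤ le_top = f.appTop from f.appLE_eq_app]
    have := hp.isIso_inr_of_isIso
    rwa [show (pullback.snd f g).appLE ⊤ ⊤ _ = (pullback.snd f g).appTop from
      (pullback.snd f g).appLE_eq_app] at this
  let E : K ≃+* Γ(pullback f g, ⊤) :=
    ((Scheme.ΓSpecIso (CommRingCat.of K)).symm ≪≫ asIso (pullback.snd f g).appTop).commRingCatIsoToRingEquiv
  have : IsDomain Γ(pullback f g, ⊤) := E.symm.toMulEquiv.isDomain K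
  exact aux_connected _ fun e he => IsIdempotentElem.iff_eq_zero_or_one.mp he
end

section
/- Let k ⊆ K be a finite Galois field extension with Galois group G, let R be a commutative k-algebra, and let B = R ⊗_k K, on which G acts by the ring automorphisms id_R ⊗ σ for σ ∈ G. Let I be an ideal of B such that (id_R ⊗ σ)(I) = I for every σ ∈ G. Then I is generated, as an ideal of B, by its intersection with the image of the canonical map R → B, r ↦ r ⊗ 1; in other words, I descends to the ideal I ∩ R of R, and I = (I ∩ R)·B. -/
open TensorProduct

/-- Let `k ⊆ K` be a finite Galois extension with Galois group `G`, `R` a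
commutative `k`-algebra and `B = R ⊗_k K`, on which `G` acts by the ring automorphisms
`id_R ⊗ σ`.  If `I` is an ideal of `B` stable under this `G`-action, then `I` is generated by
its contraction to `R`: `I = (I ∩ R) · B`, where `R → B` is the canonical map `r ↦ r ⊗ 1`. -/
theorem ideal_eq_map_comap_of_galois_stable
    (k K : Type*) [Field k] [Field K] [Algebra k K]
    [FiniteDimensional k K] [IsGalois k K]
    (R : Type*) [CommRing R] [Algebra k R]
    (I : Ideal (R ⊗[k] K))
    (hI : ∀ σ : K ≃ₐ[k] K,
      Ideal.map (Algebra.TensorProduct.map (AlgHom.id k R) σ.toAlgHom) I = I) :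
    I = Ideal.map (Algebra.TensorProduct.includeLeftRingHom : R →+* R ⊗[k] K)
        (Ideal.comap (Algebra.TensorProduct.includeLeftRingHom : R →+* R ⊗[k] K) I) := by
  classical
  refine le_antisymm ?_ Ideal.map_comap_le
  intro x hx
  let t : R ⊗[k] K →ₗ[k] R :=
    (TensorProduct.rid k R).toLinearMap ∘ₗ LinearMap.lTensor R (Algebra.trace k K)
  have ht : ∀ (r : R) (a : K), t (r ⊗ₜ a) = Algebra.trace k K a • r := by
    intro r a
    simp [t]
  have h1 : ∀ y : R ⊗[k] K, (t y) ⊗ₜ[k] (1 : K) =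
      ∑ σ : K ≃ₐ[k] K, Algebra.TensorProduct.map (AlgHom.id k R) σ.toAlgHom y := by
    intro y
    induction y with
    | zero => simp
    | add y z hy hz => simp only [map_add, TensorProduct.add_tmul, hy, hz, Finset.sum_add_distrib]
    | tmul r a =>
      rw [ht, TensorProduct.smul_tmul, ← Algebra.algebraMap_eq_smul_one,
        trace_eq_sum_automorphisms, TensorProduct.tmul_sum]
      simp
  let b := Module.finBasis k K
  have h2 : ∀ y : R ⊗[k] K, y =
      ∑ i, ((1 : R) ⊗ₜ[k] b.traceDual i) * ((t (y * ((1 : R) ⊗ₜ[k] b i))) ⊗ₜ[k] (1 : K)) := by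
    intro y
    induction y with
    | zero => simp
    | add y z hy hz =>
      simp only [add_mul, map_add, TensorProduct.add_tmul, mul_add, Finset.sum_add_distrib]
      rw [← hy, ← hz]
    | tmul r a =>
      conv_lhs => rw [← b.traceDual.sum_repr a, TensorProduct.tmul_sum]
      refine Finset.sum_congr rfl fun i _ => ?_
      rw [Module.Basis.traceDual_repr_apply, Algebra.TensorProduct.tmul_mul_tmul,
        Algebra.TensorProduct.tmul_mul_tmul, ht, Algebra.traceForm_apply]
      simp [TensorProduct.smul_tmul]
  rw [h2 x]
  refine Ideal.sum_mem _ fun i _ => Ideal.mul_mem_left _ _ ?_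
  refine Ideal.mem_map_of_mem (Algebra.TensorProduct.includeLeftRingHom : R →+* R ⊗[k] K) ?_
  rw [Ideal.mem_comap]
  change (t (x * ((1 : R) ⊗ₜ[k] b i))) ⊗ₜ[k] (1 : K) ∈ I
  rw [h1]
  refine Ideal.sum_mem _ fun σ _ => ?_
  have := Ideal.mem_map_of_mem (Algebra.TensorProduct.map (AlgHom.id k R) σ.toAlgHom)
    (I.mul_mem_right ((1 : R) ⊗ₜ[k] b i) hx)
  rwa [hI σ] at this
end
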